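/- Let β ∈ (0,∞) and h ∈ ℝ, and define ρ_max^+ := sup{ ρ ∈ [0,1] : π_ρ is stochastically dominated by ν_{β,h}^+ }. Then both measures ν_{β,h}^{+,+} and ν_{β,h}^{+,−} stochastically dominate π_{ρ_max^+}. -/

import Mathlib

open MeasureTheory Filter Topology ProbabilityTheory

noncomputable section

/-- Spin value of a Boolean spin: `true ↦ +1`, `false ↦ -1`. -/
def sval (b : Bool) : ℝ := if b then 1 else -1

/-- Two-dimensional spin configurations. -/
abbrev Cfg2 := ℤ × ℤ → Bool

/-- Two-sided sequences over an alphabet `A`. -/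
abbrev ZSeq (A : Type*) := ℤ → A

/-- Pasts: index `k` corresponds to the coordinate `-(k+1)`. -/
abbrev Past (A : Type*) := ℕ → A

/-- The four nearest neighbours of a site of `ℤ²`. -/
def nbrs (x : ℤ × ℤ) : Finset (ℤ × ℤ) :=
  {(x.1 + 1, x.2), (x.1 - 1, x.2), (x.1, x.2 + 1), (x.1, x.2 - 1)}

/-- Boltzmann weight
`exp(β[Σ_{{x,y}⊆Λ, x∼y} ω_x ω_y + Σ_{x∈Λ, y∉Λ, x∼y} ω_x σ_y] − h Σ_{x∈Λ} ω_x)`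
(the sum over unordered pairs inside `Λ` is written as half the ordered sum). -/
def isingWeight (β h : ℝ) (Λ : Finset (ℤ × ℤ)) (σ ω : Cfg2) : ℝ :=
  Real.exp (β * ((∑ x ∈ Λ, ∑ y ∈ Λ.filter (fun y => y ∈ nbrs x),
        sval (ω x) * sval (ω y)) / 2
      + ∑ x ∈ Λ, ∑ y ∈ (nbrs x).filter (fun y => y ∉ Λ), sval (ω x) * sval (σ y))
    - h * ∑ x ∈ Λ, sval (ω x))

/-- Fill in the values `τ` inside `Λ` and `σ` outside. -/
def fill (Λ : Finset (ℤ × ℤ)) (σ : Cfg2) (τ : ↥Λ → Bool) : Cfg2 :=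
  fun x => if hx : x ∈ Λ then τ ⟨x, hx⟩ else σ x

/-- The finite-volume Ising measure in `Λ` with boundary condition `σ`, viewed as a measure on
the full configuration space, the spins outside `Λ` being frozen to `σ`. -/
def isingFV (β h : ℝ) (Λ : Finset (ℤ × ℤ)) (σ : Cfg2) : Measure Cfg2 :=
  (∑ τ : ↥Λ → Bool, ENNReal.ofReal (isingWeight β h Λ σ (fill Λ σ τ)))⁻¹ •
    ∑ τ : ↥Λ → Bool,
      ENNReal.ofReal (isingWeight β h Λ σ (fill Λ σ τ)) • Measure.dirac (fill Λ σ τ)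

/-- The box `[-n,n]²`. -/
def box (n : ℕ) : Finset (ℤ × ℤ) :=
  (Finset.Icc (-(n : ℤ)) (n : ℤ)) ×ˢ (Finset.Icc (-(n : ℤ)) (n : ℤ))

/-- Convergence of a sequence of measures on a product space in the sense of convergence of the
measures of all finite-dimensional cylinder events; for probability measures on `{−1,+1}^ι`
this is exactly weak convergence. -/
def CylTendsto {ι A : Type*} [MeasurableSpace A] (μs : ℕ → Measure (ι → A))
    (μ : Measure (ι → A)) : Prop :=
  ∀ (s : Finset ι) (f : ι → A),
    Tendsto (fun n => μs n {η | ∀ i ∈ s, η i = f i}) atTop (𝓝 (μ {η | ∀ i ∈ s, η i = f i}))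

/-- `μ` is the plus phase `μ_{β,h}^+`: the weak limit of the finite-volume Ising measures on
`[-n,n]²` with all-plus boundary conditions. -/
def IsPlusPhase (β h : ℝ) (μ : Measure Cfg2) : Prop :=
  IsProbabilityMeasure μ ∧ CylTendsto (fun n => isingFV β h (box n) (fun _ => true)) μ

/-- `μ` is the minus phase `μ_{β,h}^-`. -/
def IsMinusPhase (β h : ℝ) (μ : Measure Cfg2) : Prop :=
  IsProbabilityMeasure μ ∧ CylTendsto (fun n => isingFV β h (box n) (fun _ => false)) μ

/-- The critical inverse temperature `β_c = ln(1+√2)/2`. -/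
def betaCrit : ℝ := Real.log (1 + Real.sqrt 2) / 2

/-- Projection of a two-dimensional configuration onto the line `ℤ × {0}`. -/
def lineProj (η : Cfg2) : ZSeq Bool := fun i => η (i, 0)

/-- The Schonmann projection of a measure on `{−1,+1}^{ℤ²}`. -/
def schonmann (μ : Measure Cfg2) : Measure (ZSeq Bool) := μ.map lineProj

/-- Restriction of a two-sided sequence to its strict past; index `k` is coordinate `-(k+1)`. -/
def restrictPast {A : Type*} (ω : ZSeq A) : Past A := fun k => ω (-(k + 1 : ℤ))

/-- The shift on two-sided sequences. -/
def shiftSeq {A : Type*} : ZSeq A → ZSeq A := fun ω i => ω (i + 1)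

/-- The σ-algebra `ℱ_{<0}` generated by the coordinates of negative index. -/
def pastSigma (A : Type*) [MeasurableSpace A] : MeasurableSpace (ZSeq A) :=
  MeasurableSpace.comap (fun ω : ZSeq A => restrictPast ω) inferInstance

/-- The σ-algebra generated by the coordinates in `S`. -/
def sigmaOn {ι A : Type*} [MeasurableSpace A] (S : Set ι) : MeasurableSpace (ι → A) :=
  MeasurableSpace.comap (fun ω : ι → A => S.restrict ω) inferInstance

/-- A g-function on the alphabet `A`: measurable, `[0,1]`-valued, normalized. -/
def IsGFunction {A : Type*} [Fintype A] [MeasurableSpace A] (P : A → Past A → ℝ) : Prop :=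
  (∀ a, Measurable (P a)) ∧ ∀ ω, (∑ a : A, P a ω) = 1 ∧ ∀ a, P a ω ∈ Set.Icc (0 : ℝ) 1

/-- `μ` is a translation-invariant g-measure consistent with the g-function `P`: for each `a`,
`ω ↦ P a (restrictPast ω)` is a version of the conditional probability `μ(X₀ = a | ℱ_{<0})`. -/
def IsGMeasure {A : Type*} [MeasurableSpace A] (μ : Measure (ZSeq A))
    (P : A → Past A → ℝ) : Prop :=
  IsProbabilityMeasure μ ∧ μ.map shiftSeq = μ ∧
    ∀ a : A, (fun ω => P a (restrictPast ω))
      =ᵐ[μ] μ[Set.indicator {ω : ZSeq A | ω 0 = a} (fun _ => (1 : ℝ)) | pastSigma A]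

/-- The `k`-th variation of a g-function: the supremum of `|P a ω − P a σ|` over pasts agreeing
on the coordinates `−k,…,−1`. -/
def varG {A : Type*} (P : A → Past A → ℝ) (k : ℕ) : ℝ :=
  sSup {d : ℝ | ∃ (a : A) (ω σ' : Past A), (∀ j < k, ω j = σ' j) ∧ d = |P a ω - P a σ'|}

/-- Elementary conditional probability `μ(B | A)`, as a real number. -/
def condProbR {X : Type*} [MeasurableSpace X] (μ : Measure X) (B A : Set X) : ℝ :=
  ((μ[|A]) B).toReal

/-- The event that `η_i = ω` (suitably reindexed) for `−n ≤ i ≤ −1` and `η_i = b`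
for `−(n+l) ≤ i ≤ −(n+1)`. -/
def pastEvt (n l : ℕ) (b : Bool) (ω : Past Bool) : Set (ZSeq Bool) :=
  {η | (∀ i : ℤ, -(n : ℤ) ≤ i → i ≤ -1 → η i = ω (i.natAbs - 1)) ∧
       (∀ i : ℤ, -((n : ℤ) + l) ≤ i → i ≤ -((n : ℤ) + 1) → η i = b)}

/-- The event that `η_i = b` for `−(n+l) ≤ i ≤ −n`. -/
def blockEvt (n l : ℕ) (b : Bool) : Set (ZSeq Bool) :=
  {η | ∀ i : ℤ, -((n : ℤ) + l) ≤ i → i ≤ -(n : ℤ) → η i = b}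

/-- The event that `η_i = b` for `−n ≤ i ≤ −1`. -/
def allBlock (n : ℕ) (b : Bool) : Set (ZSeq Bool) :=
  {η | ∀ i : ℤ, -(n : ℤ) ≤ i → i ≤ -1 → η i = b}

/-- `P` is the g-function `P^{+,b}` obtained from `ν` by conditioning on the symbol `b`
in the far past: `P(a|ω) = lim_n lim_l ν(η₀ = a | η = b on [−(n+l),−(n+1)], η = ω on [−n,−1])`,
both iterated limits being required to exist. -/
def IsCondG (ν : Measure (ZSeq Bool)) (b : Bool) (P : Bool → Past Bool → ℝ) : Prop :=
  ∀ (a : Bool) (ω : Past Bool), ∃ L : ℕ → ℝ,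
    (∀ n, Tendsto (fun l => condProbR ν {η | η 0 = a} (pastEvt n l b ω)) atTop (𝓝 (L n))) ∧
    Tendsto L atTop (𝓝 (P a ω))

/-- `ν'` is the iterated weak limit `lim_n lim_l ν( · | η = b on [−(n+l),−n])`. -/
def IsCondLimitMeasure (ν : Measure (ZSeq Bool)) (b : Bool) (ν' : Measure (ZSeq Bool)) : Prop :=
  ∃ νseq : ℕ → Measure (ZSeq Bool),
    (∀ n, CylTendsto (fun l => ν[|blockEvt n l b]) (νseq n)) ∧ CylTendsto νseq ν'

/-- Stochastic domination: `ν ≤ μ` iff `ν B ≤ μ B` for every increasing measurable event `B`. -/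
def StochDom {A : Type*} [MeasurableSpace A] [Preorder A]
    (ν μ : Measure (ZSeq A)) : Prop :=
  ∀ B : Set (ZSeq A), MeasurableSet B → (∀ ⦃x y : ZSeq A⦄, x ≤ y → x ∈ B → y ∈ B) → ν B ≤ μ B

/-- `π` is the i.i.d. product measure with `π(η_i = +1) = ρ` for each coordinate. -/
def IsBernoulliProd (ρ : ℝ) (π : Measure (ZSeq Bool)) : Prop :=
  IsProbabilityMeasure π ∧ ∀ (s : Finset ℤ) (f : ℤ → Bool),
    π {η | ∀ i ∈ s, η i = f i} = ∏ i ∈ s, ENNReal.ofReal (if f i then ρ else 1 - ρ)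

/-- Splicing of pasts: coordinates `−k,…,−1` (indices `< k`) from `ω`, the rest from `σ`. -/
def splice {A : Type*} (σ ω : Past A) (k : ℕ) : Past A := fun j => if j < k then ω j else σ j

/-- `ν'` is an extreme point of the convex set of g-measures consistent with `P`. -/
def ExtremeGMeasure (ν' : Measure (ZSeq Bool)) (P : Bool → Past Bool → ℝ) : Prop :=
  IsGMeasure ν' P ∧
  ∀ ν₁ ν₂ : Measure (ZSeq Bool), IsGMeasure ν₁ P → IsGMeasure ν₂ P →
    ∀ t : ℝ, t ∈ Set.Ioo (0 : ℝ) 1 →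
      ν' = ENNReal.ofReal t • ν₁ + ENNReal.ofReal (1 - t) • ν₂ → ν₁ = ν' ∧ ν₂ = ν'

/-- The event that the spins on the line are `−1` on `{−m,…,−n} × {0}`. -/
def lineMinusEvt (n m : ℕ) : Set Cfg2 :=
  {η | ∀ i : ℤ, -(m : ℤ) ≤ i → i ≤ -(n : ℤ) → η (i, 0) = false}

/-- Nearest-neighbour adjacency in `ℤ²` (`‖x−y‖₁ = 1`). -/
def adj2 (x y : ℤ × ℤ) : Prop := (x.1 - y.1).natAbs + (x.2 - y.2).natAbs = 1

/-- The event `A_n`: there is an infinite nearest-neighbour path of `+1` spins starting at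
`(n,0)` entirely contained in the half-plane `{x ≤ n}`. -/
def plusPathEvt (n : ℕ) : Set Cfg2 :=
  {η | ∃ γ : ℕ → ℤ × ℤ, γ 0 = ((n : ℤ), 0) ∧ (∀ j, adj2 (γ j) (γ (j + 1))) ∧
    Function.Injective γ ∧ (∀ j, (γ j).1 ≤ (n : ℤ)) ∧ ∀ j, η (γ j) = true}

/-- The block map for the decimation `ν_{l,k}`: the `j`-th letter consists of the spins on
`[j(k+l), j(k+l)+l−1]`. -/
def blockMap (l k : ℕ) (η : ZSeq Bool) : ZSeq (Fin l → Bool) :=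
  fun j r => η (j * ((k : ℤ) + l) + r)

end

/-- The configurations that are plus outside `Λ`. -/
noncomputable def plusCfgs (Λ : Finset (ℤ × ℤ)) : Finset Cfg2 := by
  classical exact Finset.univ.image (fill Λ (fun _ => true))

/-- Unnormalised weight of the event `E` under the plus boundary condition on `Λ`. -/
noncomputable def plusSum (β h : ℝ) (Λ : Finset (ℤ × ℤ)) (E : Set Cfg2) : ℝ :=
  ∑ ω ∈ plusCfgs Λ, E.indicator (isingWeight β h Λ (fun _ => true)) ω

theorem mem_plusCfgs {Λ : Finset (ℤ × ℤ)} {ω : Cfg2} :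
    ω ∈ plusCfgs Λ ↔ ∀ x ∉ Λ, ω x = true := by
  classical
  simp only [plusCfgs, Finset.mem_image, Finset.mem_univ, true_and]
  constructor
  · rintro ⟨τ, rfl⟩ x hx
    simp [fill, hx]
  · intro hω
    refine ⟨fun x => ω x, ?_⟩
    funext x
    by_cases hx : x ∈ Λ
    · simp [fill, hx]
    · simp [fill, hx, hω x hx]

theorem fill_injective (Λ : Finset (ℤ × ℤ)) (σ : Cfg2) : Function.Injective (fill Λ σ) := by
  intro τ τ' hττ
  funext x
  simpa [fill] using congrFun hττ x

theorem isingWeight_pos (β h : ℝ) (Λ : Finset (ℤ × ℤ)) (σ ω : Cfg2) :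
    0 < isingWeight β h Λ σ ω := Real.exp_pos _

theorem plusSum_nonneg (β h : ℝ) (Λ : Finset (ℤ × ℤ)) (E : Set Cfg2) : 0 ≤ plusSum β h Λ E :=
  Finset.sum_nonneg fun ω _ => Set.indicator_nonneg (fun ω _ => (isingWeight_pos β h Λ _ ω).le) ω

theorem plusSum_univ_pos (β h : ℝ) (Λ : Finset (ℤ × ℤ)) : 0 < plusSum β h Λ Set.univ := by
  unfold plusSum
  simp only [Set.indicator_univ]
  exact Finset.sum_pos (fun ω _ => isingWeight_pos β h Λ _ ω)
    ⟨fun _ => true, mem_plusCfgs.2 fun _ _ => rfl⟩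

theorem isingFV_real (β h : ℝ) (Λ : Finset (ℤ × ℤ)) {E : Set Cfg2} (hE : MeasurableSet E) :
    (isingFV β h Λ (fun _ => true)).real E = plusSum β h Λ E / plusSum β h Λ Set.univ := by
  classical
  have key : ∀ F : Set Cfg2, ∑ τ : ↥Λ → Bool, F.indicator (isingWeight β h Λ (fun _ => true))
      (fill Λ (fun _ => true) τ) = plusSum β h Λ F := by
    intro F
    rw [plusSum, plusCfgs, Finset.sum_image fun a _ b _ hab => fill_injective Λ _ hab]
  have h1 : (∑ τ : ↥Λ → Bool,
      ENNReal.ofReal (isingWeight β h Λ (fun _ => true) (fill Λ (fun _ => true) τ))) =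
      ENNReal.ofReal (plusSum β h Λ Set.univ) := by
    rw [← key, ENNReal.ofReal_sum_of_nonneg]
    · simp
    · intro τ _
      simpa using (isingWeight_pos β h Λ _ _).le
  have h2 : (∑ τ : ↥Λ → Bool, ENNReal.ofReal (isingWeight β h Λ (fun _ => true)
      (fill Λ (fun _ => true) τ)) * Measure.dirac (fill Λ (fun _ => true) τ) E) =
      ENNReal.ofReal (plusSum β h Λ E) := by
    rw [← key, ENNReal.ofReal_sum_of_nonneg]
    · refine Finset.sum_congr rfl fun τ _ => ?_
      rw [Measure.dirac_apply' _ hE]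
      by_cases hτ : fill Λ (fun _ => true) τ ∈ E <;> simp [hτ]
    · intro τ _
      exact Set.indicator_nonneg (fun ω _ => (isingWeight_pos β h Λ _ ω).le) _
  simp only [Measure.real, isingFV, Measure.smul_apply, Measure.finsetSum_apply, smul_eq_mul,
    ENNReal.toReal_mul, ENNReal.toReal_inv]
  rw [h1, h2, ENNReal.toReal_ofReal (plusSum_nonneg ..), ENNReal.toReal_ofReal (plusSum_nonneg ..)]
  ring

theorem sval_inf_add_sval_sup (a b : Bool) :
    sval (a ⊓ b) + sval (a ⊔ b) = sval a + sval b := by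
  cases a <;> cases b <;> simp [sval]

theorem sval_mul_supermodular (a b c d : Bool) :
    sval a * sval b + sval c * sval d ≤
      sval (a ⊓ c) * sval (b ⊓ d) + sval (a ⊔ c) * sval (b ⊔ d) := by
  cases a <;> cases b <;> cases c <;> cases d <;> norm_num [sval]

theorem isingWeight_supermodular {β : ℝ} (hβ : 0 ≤ β) (h : ℝ) (Λ : Finset (ℤ × ℤ))
    (σ ω ω' : Cfg2) :
    isingWeight β h Λ σ ω * isingWeight β h Λ σ ω' ≤
      isingWeight β h Λ σ (ω ⊓ ω') * isingWeight β h Λ σ (ω ⊔ ω') := by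
  unfold isingWeight
  rw [← Real.exp_add, ← Real.exp_add, Real.exp_le_exp]
  set S : Cfg2 → ℝ := fun ω => ∑ x ∈ Λ, ∑ y ∈ Λ.filter (fun y => y ∈ nbrs x),
    sval (ω x) * sval (ω y) with hS
  set T : Cfg2 → ℝ := fun ω => ∑ x ∈ Λ, ∑ y ∈ (nbrs x).filter (fun y => y ∉ Λ),
    sval (ω x) * sval (σ y) with hT
  set M : Cfg2 → ℝ := fun ω => ∑ x ∈ Λ, sval (ω x) with hM
  have h1 : S ω + S ω' ≤ S (ω ⊓ ω') + S (ω ⊔ ω') := by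
    simp only [hS, ← Finset.sum_add_distrib]
    exact Finset.sum_le_sum fun x _ => Finset.sum_le_sum fun y _ => sval_mul_supermodular _ _ _ _
  have h2 : T ω + T ω' = T (ω ⊓ ω') + T (ω ⊔ ω') := by
    simp only [hT, ← Finset.sum_add_distrib, ← add_mul]
    refine Finset.sum_congr rfl fun x _ => Finset.sum_congr rfl fun y _ => ?_
    rw [Pi.inf_apply, Pi.sup_apply, sval_inf_add_sval_sup]
  have h3 : M ω + M ω' = M (ω ⊓ ω') + M (ω ⊔ ω') := by
    simp only [hM, ← Finset.sum_add_distrib]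
    refine Finset.sum_congr rfl fun x _ => ?_
    rw [Pi.inf_apply, Pi.sup_apply, sval_inf_add_sval_sup]
  change β * (S ω / 2 + T ω) - h * M ω + (β * (S ω' / 2 + T ω') - h * M ω') ≤
    β * (S (ω ⊓ ω') / 2 + T (ω ⊓ ω')) - h * M (ω ⊓ ω') +
      (β * (S (ω ⊔ ω') / 2 + T (ω ⊔ ω')) - h * M (ω ⊔ ω'))
  have h4 := mul_le_mul_of_nonneg_left h1 hβ
  linear_combination h4 / 2 + β * h2 - h * h3

theorem plusSum_four_events {β : ℝ} (hβ : 0 ≤ β) (h : ℝ) (Λ : Finset (ℤ × ℤ))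
    {E₁ E₂ E₃ E₄ : Set Cfg2}
    (hE : ∀ ω ∈ E₁, ∀ ω' ∈ E₂, ω ⊓ ω' ∈ E₃ ∧ ω ⊔ ω' ∈ E₄) :
    plusSum β h Λ E₁ * plusSum β h Λ E₂ ≤ plusSum β h Λ E₃ * plusSum β h Λ E₄ := by
  classical
  have hn : ∀ F : Set Cfg2, 0 ≤ F.indicator (isingWeight β h Λ (fun _ => true)) := fun F ω =>
    Set.indicator_nonneg (fun ω _ => (isingWeight_pos β h Λ _ ω).le) ω
  have := four_functions_theorem _ _ _ _ (hn E₁) (hn E₂) (hn E₃) (hn E₄) ?_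
    (plusCfgs Λ) (plusCfgs Λ)
  · refine this.trans ?_
    refine mul_le_mul (Finset.sum_le_sum_of_subset_of_nonneg ?_ fun ω _ _ => hn _ ω)
      (Finset.sum_le_sum_of_subset_of_nonneg ?_ fun ω _ _ => hn _ ω)
      (Finset.sum_nonneg fun ω _ => hn _ ω) (plusSum_nonneg ..)
    · refine Finset.infs_subset_iff.2 fun a ha b hb => mem_plusCfgs.2 fun x hx => ?_
      simp [mem_plusCfgs.1 ha x hx, mem_plusCfgs.1 hb x hx]
    · refine Finset.sups_subset_iff.2 fun a ha b hb => mem_plusCfgs.2 fun x hx => ?_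
      simp [mem_plusCfgs.1 ha x hx]
  · intro a b
    by_cases ha : a ∈ E₁
    · by_cases hb : b ∈ E₂
      · obtain ⟨h3, h4⟩ := hE a ha b hb
        simp only [Set.indicator_of_mem ha, Set.indicator_of_mem hb, Set.indicator_of_mem h3,
          Set.indicator_of_mem h4]
        exact isingWeight_supermodular hβ h Λ _ a b
      · simp only [Set.indicator_of_notMem hb, mul_zero]
        exact mul_nonneg (hn _ _) (hn _ _)
    · simp only [Set.indicator_of_notMem ha, zero_mul]
      exact mul_nonneg (hn _ _) (hn _ _)

theorem mem_nbrs_comm {x y : ℤ × ℤ} : y ∈ nbrs x ↔ x ∈ nbrs y := by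
  obtain ⟨a, b⟩ := x
  obtain ⟨c, d⟩ := y
  simp only [nbrs, Finset.mem_insert, Finset.mem_singleton, Prod.mk.injEq]
  omega

/-- The contribution to the energy of `Λ'` of the pairs not touching `Λ`. -/
noncomputable def outerWeight (β h : ℝ) (Λ Λ' : Finset (ℤ × ℤ)) (ω : Cfg2) : ℝ :=
  Real.exp (β * ((∑ x ∈ Λ' \ Λ, ∑ y ∈ (Λ' \ Λ).filter (fun y => y ∈ nbrs x),
        sval (ω x) * sval (ω y)) / 2
      + ∑ x ∈ Λ' \ Λ, ∑ y ∈ (nbrs x).filter (fun y => y ∉ Λ'), sval (ω x) * sval (ω y))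
    - h * ∑ x ∈ Λ' \ Λ, sval (ω x))

theorem isingWeight_eq_mul_outerWeight (β h : ℝ) {Λ Λ' : Finset (ℤ × ℤ)} (hΛ : Λ ⊆ Λ')
    (ω : Cfg2) :
    isingWeight β h Λ' ω ω = isingWeight β h Λ ω ω * outerWeight β h Λ Λ' ω := by
  classical
  unfold isingWeight outerWeight
  rw [← Real.exp_add]
  congr 1
  set p : ℤ × ℤ → ℤ × ℤ → ℝ := fun x y => if y ∈ nbrs x then sval (ω x) * sval (ω y) else 0
    with hp
  have hpc : ∀ x y, p x y = p y x := by
    intro x y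
    simp only [hp]
    rw [mul_comm]
    exact if_congr mem_nbrs_comm rfl rfl
  have hsplit : ∀ f : ℤ × ℤ → ℝ, ∑ x ∈ Λ', f x = ∑ x ∈ Λ, f x + ∑ x ∈ Λ' \ Λ, f x := fun f => by
    rw [add_comm, Finset.sum_sdiff hΛ]
  have h1 : ∀ A B : Finset (ℤ × ℤ), (∑ x ∈ A, ∑ y ∈ B.filter (fun y => y ∈ nbrs x),
      sval (ω x) * sval (ω y)) = ∑ x ∈ A, ∑ y ∈ B, p x y := fun A B =>
    Finset.sum_congr rfl fun x _ => Finset.sum_filter _ _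
  have h2 : ∀ x, (∑ y ∈ (nbrs x).filter (fun y => y ∉ Λ), sval (ω x) * sval (ω y)) =
      (∑ y ∈ (nbrs x).filter (fun y => y ∉ Λ'), sval (ω x) * sval (ω y)) +
        ∑ y ∈ Λ' \ Λ, p x y := by
    intro x
    rw [show (∑ y ∈ Λ' \ Λ, p x y) = ∑ y ∈ (Λ' \ Λ).filter (fun y => y ∈ nbrs x),
      sval (ω x) * sval (ω y) from (Finset.sum_filter _ _).symm, ← Finset.sum_union]
    · refine Finset.sum_congr ?_ fun _ _ => rfl
      ext y
      simp only [Finset.mem_filter, Finset.mem_union, Finset.mem_sdiff]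
      have := @hΛ y
      tauto
    · rw [Finset.disjoint_left]
      intro y hy hy'
      simp only [Finset.mem_filter, Finset.mem_sdiff] at hy hy'
      exact hy.2 hy'.1.1
  have h3 : ∑ x ∈ Λ' \ Λ, ∑ y ∈ Λ, p x y = ∑ x ∈ Λ, ∑ y ∈ Λ' \ Λ, p x y := by
    rw [Finset.sum_comm]
    exact Finset.sum_congr rfl fun x _ => Finset.sum_congr rfl fun y _ => hpc _ _
  have h4 : ∑ x ∈ Λ', ∑ y ∈ Λ', p x y = ∑ x ∈ Λ, ∑ y ∈ Λ, p x y +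
      2 * (∑ x ∈ Λ, ∑ y ∈ Λ' \ Λ, p x y) + ∑ x ∈ Λ' \ Λ, ∑ y ∈ Λ' \ Λ, p x y := by
    rw [hsplit]
    simp only [hsplit (p _), Finset.sum_add_distrib]
    rw [h3]
    ring
  rw [h1, h1, h1, h4, hsplit (fun x => sval (ω x)),
    hsplit (fun x => ∑ y ∈ (nbrs x).filter (fun y => y ∉ Λ'), sval (ω x) * sval (ω y)),
    Finset.sum_congr rfl (fun x _ => h2 x), Finset.sum_add_distrib]
  ring

theorem outerWeight_congr (β h : ℝ) {Λ Λ' : Finset (ℤ × ℤ)} (hΛ : Λ ⊆ Λ') {ω ω' : Cfg2}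
    (hω : ∀ x ∉ Λ, ω x = ω' x) : outerWeight β h Λ Λ' ω = outerWeight β h Λ Λ' ω' := by
  have hD : ∀ x ∈ Λ' \ Λ, ω x = ω' x := fun x hx => hω x (Finset.mem_sdiff.1 hx).2
  unfold outerWeight
  congr 3
  · congr 1
    · congr 1
      refine Finset.sum_congr rfl fun x hx => Finset.sum_congr rfl fun y hy => ?_
      rw [hD x hx, hD y (Finset.mem_filter.1 hy).1]
    · refine Finset.sum_congr rfl fun x hx => Finset.sum_congr rfl fun y hy => ?_
      rw [hD x hx, hω y fun hy' => (Finset.mem_filter.1 hy).2 (hΛ hy')]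
  · exact Finset.sum_congr rfl fun x hx => by rw [hD x hx]

theorem isingWeight_congr_boundary (β h : ℝ) (Λ : Finset (ℤ × ℤ)) {σ σ' : Cfg2} (ω : Cfg2)
    (hσ : ∀ x ∉ Λ, σ x = σ' x) : isingWeight β h Λ σ ω = isingWeight β h Λ σ' ω := by
  unfold isingWeight
  congr 4
  refine Finset.sum_congr rfl fun x hx => Finset.sum_congr rfl fun y hy => ?_
  rw [hσ y (Finset.mem_filter.1 hy).2]

/-- The event that the spins agree with `f` on `s`. -/
def cyl {ι : Type*} (s : Finset ι) (f : ι → Bool) : Set (ι → Bool) := {η | ∀ i ∈ s, η i = f i}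

/-- Enlarging the box with plus boundary condition makes minus spins more likely. -/
theorem plusSum_minus_mono {β : ℝ} (hβ : 0 ≤ β) (h : ℝ) {Λ Λ' : Finset (ℤ × ℤ)} (hΛ : Λ ⊆ Λ')
    (s : Finset (ℤ × ℤ)) :
    plusSum β h Λ (cyl s fun _ => false) / plusSum β h Λ Set.univ ≤
      plusSum β h Λ' (cyl s fun _ => false) / plusSum β h Λ' Set.univ := by
  classical
  set P : Set Cfg2 := {ω | ∀ x ∈ Λ' \ Λ, ω x = true} with hP
  set c := outerWeight β h Λ Λ' (fun _ => true) with hc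
  have hc0 : 0 < c := Real.exp_pos _
  have key : ∀ E : Set Cfg2, plusSum β h Λ' (E ∩ P) = c * plusSum β h Λ E := by
    intro E
    have hsub : plusCfgs Λ ⊆ plusCfgs Λ' := fun ω hω =>
      mem_plusCfgs.2 fun x hx => mem_plusCfgs.1 hω x fun hx' => hx (hΛ hx')
    unfold plusSum
    rw [Finset.mul_sum, ← Finset.sum_subset hsub]
    · refine Finset.sum_congr rfl fun ω hω => ?_
      have hω' := mem_plusCfgs.1 hω
      have hωP : ω ∈ P := fun x hx => hω' x (Finset.mem_sdiff.1 hx).2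
      by_cases hE : ω ∈ E
      · rw [Set.indicator_of_mem (Set.mem_inter hE hωP), Set.indicator_of_mem hE,
          isingWeight_congr_boundary β h Λ' (σ' := ω) ω
            (fun x hx => (hω' x fun hx' => hx (hΛ hx')).symm),
          isingWeight_congr_boundary β h Λ (σ' := ω) ω (fun x hx => (hω' x hx).symm),
          isingWeight_eq_mul_outerWeight β h hΛ, mul_comm,
          outerWeight_congr β h hΛ (ω' := fun _ => true) hω']
      · rw [Set.indicator_of_notMem (fun H => hE H.1), Set.indicator_of_notMem hE, mul_zero]
    · intro ω hω hω'
      refine Set.indicator_of_notMem (fun H => hω' (mem_plusCfgs.2 fun x hx => ?_)) _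
      by_cases hx' : x ∈ Λ'
      · exact H.2 x (Finset.mem_sdiff.2 ⟨hx', hx⟩)
      · exact mem_plusCfgs.1 hω x hx'
  have h4 := plusSum_four_events hβ h Λ' (E₁ := cyl s (fun _ => false) ∩ P) (E₂ := Set.univ)
    (E₃ := cyl s fun _ => false) (E₄ := Set.univ ∩ P) ?_
  · rw [key, key] at h4
    rw [div_le_div_iff₀ (plusSum_univ_pos ..) (plusSum_univ_pos ..)]
    exact le_of_mul_le_mul_left (by linarith) hc0
  · intro ω hω ω' _
    refine ⟨fun x hx => ?_, trivial, fun x hx => ?_⟩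
    · simp [hω.1 x hx]
    · simp [hω.2 x hx]

theorem nbrs_add (x v : ℤ × ℤ) : nbrs (x + v) = (nbrs x).map (addRightEmbedding v) := by
  ext ⟨a, b⟩
  obtain ⟨c, d⟩ := x
  obtain ⟨e, f⟩ := v
  simp only [nbrs, Finset.mem_insert, Finset.mem_singleton, Finset.mem_map,
    addRightEmbedding_apply, Prod.mk.injEq, exists_eq_or_imp, exists_eq_left, Prod.mk_add_mk]
  omega

theorem isingWeight_translate (β h : ℝ) (Λ : Finset (ℤ × ℤ)) (v : ℤ × ℤ) (b : Bool) (ω : Cfg2) :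
    isingWeight β h (Λ.map (addRightEmbedding v)) (fun _ => b) ω =
      isingWeight β h Λ (fun _ => b) (fun x => ω (x + v)) := by
  classical
  unfold isingWeight
  simp only [Finset.sum_map, addRightEmbedding_apply, Finset.filter_map, nbrs_add]
  congr 4
  · congr 1
    refine Finset.sum_congr rfl fun x _ => Finset.sum_congr ?_ fun _ _ => rfl
    ext y
    simp [Function.comp]
  · refine Finset.sum_congr rfl fun x _ => Finset.sum_congr ?_ fun _ _ => rfl
    ext y
    simp [Function.comp]

theorem plusSum_translate (β h : ℝ) (Λ : Finset (ℤ × ℤ)) (v : ℤ × ℤ) (E : Set Cfg2) :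
    plusSum β h (Λ.map (addRightEmbedding v)) {ω | (fun x => ω (x + v)) ∈ E} =
      plusSum β h Λ E := by
  classical
  unfold plusSum
  refine Finset.sum_bij' (fun ω _ => fun x => ω (x + v)) (fun ω _ => fun x => ω (x - v))
    ?_ ?_ ?_ ?_ ?_
  · intro ω hω
    refine mem_plusCfgs.2 fun x hx => mem_plusCfgs.1 hω _ ?_
    simpa using hx
  · intro ω hω
    refine mem_plusCfgs.2 fun x hx => mem_plusCfgs.1 hω _ fun hx' => hx ?_
    exact Finset.mem_map.2 ⟨x - v, hx', by simp⟩
  · intro ω _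
    simp
  · intro ω _
    simp
  · intro ω _
    simp only [Set.indicator_apply, Set.mem_ofPred_eq, isingWeight_translate]

theorem isingWeight_bounds (β h : ℝ) (s : Finset (ℤ × ℤ)) :
    ∃ K : ℝ, 0 < K ∧ ∀ σ ω σ' ω' : Cfg2, isingWeight β h s σ ω ≤ K * isingWeight β h s σ' ω' := by
  classical
  have hs : ∀ a : Bool, |sval a| = 1 := by intro a; cases a <;> simp [sval]
  obtain ⟨B, hB⟩ : ∃ B : ℝ, ∀ σ ω : Cfg2, |β * ((∑ x ∈ s, ∑ y ∈ s.filter (fun y => y ∈ nbrs x),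
        sval (ω x) * sval (ω y)) / 2
      + ∑ x ∈ s, ∑ y ∈ (nbrs x).filter (fun y => y ∉ s), sval (ω x) * sval (σ y))
    - h * ∑ x ∈ s, sval (ω x)| ≤ B := by
    refine ⟨|β| * ((∑ x ∈ s, ∑ y ∈ s.filter (fun y => y ∈ nbrs x), (1 : ℝ)) / 2
      + ∑ x ∈ s, ∑ y ∈ (nbrs x).filter (fun y => y ∉ s), (1 : ℝ)) + |h| * ∑ x ∈ s, (1 : ℝ),
      fun σ ω => ?_⟩
    refine (abs_sub _ _).trans ?_
    rw [abs_mul, abs_mul]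
    refine add_le_add (mul_le_mul_of_nonneg_left ((abs_add_le _ _).trans (add_le_add ?_ ?_))
      (abs_nonneg _)) (mul_le_mul_of_nonneg_left ?_ (abs_nonneg _))
    · rw [abs_div, abs_two]
      refine div_le_div_of_nonneg_right ?_ zero_le_two
      refine (Finset.abs_sum_le_sum_abs _ _).trans (Finset.sum_le_sum fun x _ => ?_)
      refine (Finset.abs_sum_le_sum_abs _ _).trans (Finset.sum_le_sum fun y _ => ?_)
      rw [abs_mul, hs, hs, one_mul]
    · refine (Finset.abs_sum_le_sum_abs _ _).trans (Finset.sum_le_sum fun x _ => ?_)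
      refine (Finset.abs_sum_le_sum_abs _ _).trans (Finset.sum_le_sum fun y _ => ?_)
      rw [abs_mul, hs, hs, one_mul]
    · refine (Finset.abs_sum_le_sum_abs _ _).trans (Finset.sum_le_sum fun x _ => ?_)
      rw [hs]
  refine ⟨Real.exp (2 * B), Real.exp_pos _, fun σ ω σ' ω' => ?_⟩
  unfold isingWeight
  rw [← Real.exp_add, Real.exp_le_exp]
  have h1 := (abs_le.1 (hB σ ω)).2
  have h2 := (abs_le.1 (hB σ' ω')).1
  linarith

/-- Finite energy: cylinder probabilities on a fixed set of sites are comparable uniformly in the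
volume. -/
theorem plusSum_cyl_le (β h : ℝ) (s : Finset (ℤ × ℤ)) :
    ∃ K : ℝ, 0 < K ∧ ∀ Λ : Finset (ℤ × ℤ), s ⊆ Λ → ∀ f g : Cfg2,
      plusSum β h Λ (cyl s g) ≤ K * plusSum β h Λ (cyl s f) := by
  classical
  obtain ⟨K, hK, hKb⟩ := isingWeight_bounds β h s
  refine ⟨K, hK, fun Λ hs f g => ?_⟩
  set φ : Cfg2 → Cfg2 := fun ω x => if x ∈ s then f x else ω x with hφ
  have hφs : ∀ ω, φ ω ∈ cyl s f := fun ω x hx => by simp [hφ, hx]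
  have hφΛ : ∀ ω ∈ plusCfgs Λ, φ ω ∈ plusCfgs Λ := fun ω hω => mem_plusCfgs.2 fun x hx => by
    have hxs : x ∉ s := fun hx' => hx (hs hx')
    simp [hφ, hxs, mem_plusCfgs.1 hω x hx]
  have hw : ∀ ω ∈ plusCfgs Λ, isingWeight β h Λ (fun _ => true) ω ≤
      K * isingWeight β h Λ (fun _ => true) (φ ω) := by
    intro ω hω
    rw [isingWeight_congr_boundary β h Λ (σ' := ω) ω fun x hx => (mem_plusCfgs.1 hω x hx).symm,
      isingWeight_congr_boundary β h Λ (σ' := φ ω) (φ ω)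
        fun x hx => (mem_plusCfgs.1 (hφΛ ω hω) x hx).symm,
      isingWeight_eq_mul_outerWeight β h hs, isingWeight_eq_mul_outerWeight β h hs,
      outerWeight_congr β h hs (ω' := φ ω) fun x hx => by simp [hφ, hx], ← mul_assoc]
    exact mul_le_mul_of_nonneg_right (hKb _ _ _ _) (Real.exp_pos _).le
  have hsum : ∀ e : Cfg2, plusSum β h Λ (cyl s e) =
      ∑ ω ∈ (plusCfgs Λ).filter (fun ω => ω ∈ cyl s e),
        isingWeight β h Λ (fun _ => true) ω := fun e => by
    rw [Finset.sum_filter]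
    exact Finset.sum_congr rfl fun ω _ => by rw [Set.indicator_apply]
  rw [hsum, hsum, Finset.mul_sum]
  calc _ ≤ ∑ ω ∈ (plusCfgs Λ).filter (fun ω => ω ∈ cyl s g),
        K * isingWeight β h Λ (fun _ => true) (φ ω) :=
        Finset.sum_le_sum fun ω hω => hw ω (Finset.mem_filter.1 hω).1
    _ = ∑ ω ∈ ((plusCfgs Λ).filter (fun ω => ω ∈ cyl s g)).image φ,
        K * isingWeight β h Λ (fun _ => true) ω := by
        rw [Finset.sum_image]
        intro a ha b hb hab
        funext x
        by_cases hx : x ∈ s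
        · rw [(Finset.mem_filter.1 ha).2 x hx, (Finset.mem_filter.1 hb).2 x hx]
        · simpa [hφ, hx] using congrFun hab x
    _ ≤ _ := by
        refine Finset.sum_le_sum_of_subset_of_nonneg ?_ fun ω _ _ =>
          mul_nonneg hK.le (isingWeight_pos ..).le
        refine Finset.image_subset_iff.2 fun ω hω => Finset.mem_filter.2 ⟨?_, hφs ω⟩
        exact hφΛ ω (Finset.mem_filter.1 hω).1

theorem mem_cyl {ι : Type*} {s : Finset ι} {f η : ι → Bool} :
    η ∈ cyl s f ↔ ∀ i ∈ s, η i = f i := Iff.rfl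

theorem measurableSet_cyl {ι : Type*} (s : Finset ι) (f : ι → Bool) :
    MeasurableSet (cyl s f) := by
  have : cyl s f = ⋂ i ∈ s, (fun η : ι → Bool => η i) ⁻¹' {f i} := by
    ext η
    simp [mem_cyl]
  rw [this]
  exact Finset.measurableSet_biInter s fun i _ =>
    measurable_pi_apply i (measurableSet_singleton _)

theorem IsPlusPhase.tendsto_plusSum {β h : ℝ} {μ : Measure Cfg2} (hμ : IsPlusPhase β h μ)
    (s : Finset (ℤ × ℤ)) (f : Cfg2) :
    Tendsto (fun n => plusSum β h (box n) (cyl s f) / plusSum β h (box n) Set.univ) atTop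
      (𝓝 (μ.real (cyl s f))) := by
  have := hμ.1
  have h1 := (ENNReal.tendsto_toReal (measure_ne_top μ (cyl s f))).comp (hμ.2 s f)
  refine h1.congr fun n => ?_
  exact isingFV_real β h (box n) (measurableSet_cyl s f)

theorem IsPlusPhase.four_cyl {β h : ℝ} (hβ : 0 ≤ β) {μ : Measure Cfg2} (hμ : IsPlusPhase β h μ)
    {s₁ s₂ s₃ s₄ : Finset (ℤ × ℤ)} {f₁ f₂ f₃ f₄ : Cfg2}
    (hE : ∀ ω ∈ cyl s₁ f₁, ∀ ω' ∈ cyl s₂ f₂, ω ⊓ ω' ∈ cyl s₃ f₃ ∧ ω ⊔ ω' ∈ cyl s₄ f₄) :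
    μ.real (cyl s₁ f₁) * μ.real (cyl s₂ f₂) ≤ μ.real (cyl s₃ f₃) * μ.real (cyl s₄ f₄) := by
  refine le_of_tendsto_of_tendsto' ((hμ.tendsto_plusSum s₁ f₁).mul (hμ.tendsto_plusSum s₂ f₂))
    ((hμ.tendsto_plusSum s₃ f₃).mul (hμ.tendsto_plusSum s₄ f₄)) fun n => ?_
  rw [div_mul_div_comm, div_mul_div_comm]
  exact div_le_div_of_nonneg_right (plusSum_four_events hβ h (box n) hE)
    (mul_nonneg (plusSum_nonneg ..) (plusSum_nonneg ..))

theorem IsPlusPhase.minus_le_translate {β h : ℝ} (hβ : 0 ≤ β) {μ : Measure Cfg2}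
    (hμ : IsPlusPhase β h μ) (s : Finset (ℤ × ℤ)) {v : ℤ × ℤ}
    (hv : ∀ n, (box n).map (addRightEmbedding v) ⊆ box (n + 1)) :
    μ.real (cyl s fun _ => false) ≤
      μ.real (cyl (s.map (addRightEmbedding v)) fun _ => false) := by
  refine le_of_tendsto_of_tendsto' (hμ.tendsto_plusSum s _)
    ((tendsto_add_atTop_iff_nat 1).2 (hμ.tendsto_plusSum _ _)) fun n => ?_
  refine le_trans (le_of_eq ?_) (plusSum_minus_mono hβ h (hv n) _)
  rw [← plusSum_translate β h (box n) v, ← plusSum_translate β h (box n) v Set.univ]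
  congr 2
  ext ω
  simp only [cyl, Set.mem_ofPred_eq, Finset.forall_mem_map, addRightEmbedding_apply]

theorem IsPlusPhase.minus_translate {β h : ℝ} (hβ : 0 ≤ β) {μ : Measure Cfg2}
    (hμ : IsPlusPhase β h μ) (s : Finset (ℤ × ℤ)) :
    μ.real (cyl (s.map (addRightEmbedding ((1, 0) : ℤ × ℤ))) fun _ => false) =
      μ.real (cyl s fun _ => false) := by
  have hsub : ∀ e : ℤ, |e| ≤ 1 → ∀ n : ℕ,
      (box n).map (addRightEmbedding ((e, 0) : ℤ × ℤ)) ⊆ box (n + 1) := by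
    intro e he n x hx
    rw [abs_le] at he
    obtain ⟨y, hy, rfl⟩ := Finset.mem_map.1 hx
    simp only [box, Finset.mem_product, Finset.mem_Icc, addRightEmbedding_apply, Prod.fst_add,
      Prod.snd_add] at hy ⊢
    push_cast
    omega
  refine le_antisymm ?_ (hμ.minus_le_translate hβ s (hsub 1 (by simp)))
  refine (hμ.minus_le_translate hβ _ (hsub (-1) (by simp))).trans (le_of_eq ?_)
  rw [Finset.map_map]
  congr 2
  convert Finset.map_refl
  ext x <;> simp

theorem exists_subset_box (s : Finset (ℤ × ℤ)) : ∃ N, ∀ n ≥ N, s ⊆ box n := by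
  refine ⟨∑ x ∈ s, (x.1.natAbs + x.2.natAbs), fun n hn x hx => ?_⟩
  have := Finset.single_le_sum (f := fun x : ℤ × ℤ => x.1.natAbs + x.2.natAbs)
    (fun _ _ => Nat.zero_le _) hx
  simp only [box, Finset.mem_product, Finset.mem_Icc]
  omega

theorem IsPlusPhase.cyl_pos {β h : ℝ} {μ : Measure Cfg2} (hμ : IsPlusPhase β h μ)
    (s : Finset (ℤ × ℤ)) (f : Cfg2) : 0 < μ.real (cyl s f) := by
  classical
  have := hμ.1
  obtain ⟨K, hK, hKle⟩ := plusSum_cyl_le β h s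
  obtain ⟨N, hN⟩ := exists_subset_box s
  have hle : ∀ g : Cfg2, μ.real (cyl s g) ≤ K * μ.real (cyl s f) := by
    intro g
    refine le_of_tendsto_of_tendsto (hμ.tendsto_plusSum s g)
      ((hμ.tendsto_plusSum s f).const_mul K) ?_
    filter_upwards [eventually_ge_atTop N] with n hn
    rw [← mul_div_assoc]
    exact div_le_div_of_nonneg_right (hKle _ (hN n hn) f g) (plusSum_nonneg ..)
  by_contra hcon
  have h0 : μ.real (cyl s f) = 0 := le_antisymm (not_lt.1 hcon) measureReal_nonneg
  have hall : ∀ g : Cfg2, μ (cyl s g) = 0 := by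
    intro g
    have h1 := hle g
    rw [h0, mul_zero] at h1
    exact (measureReal_eq_zero_iff).1 (le_antisymm h1 measureReal_nonneg)
  have hcov : (Set.univ : Set Cfg2) ⊆
      ⋃ τ : ↥s → Bool, cyl s (fill s (fun _ => true) τ) := by
    intro ω _
    refine Set.mem_iUnion.2 ⟨fun x => ω x, fun x hx => ?_⟩
    simp [fill, hx]
  have := measure_mono_null hcov (measure_iUnion_null fun τ => hall _)
  simp at this

/-- The properties of the Schonmann projection of the plus phase that drive the argument: the
four-function inequality for cylinder events, translation invariance of the probabilities of
intervals of minus spins, and finite energy. -/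
structure IsFKGLine (ν : Measure (ZSeq Bool)) : Prop where
  prob : IsProbabilityMeasure ν
  four : ∀ (s₁ s₂ s₃ s₄ : Finset ℤ) (f₁ f₂ f₃ f₄ : ZSeq Bool),
    (∀ ω ∈ cyl s₁ f₁, ∀ ω' ∈ cyl s₂ f₂, ω ⊓ ω' ∈ cyl s₃ f₃ ∧ ω ⊔ ω' ∈ cyl s₄ f₄) →
    ν.real (cyl s₁ f₁) * ν.real (cyl s₂ f₂) ≤ ν.real (cyl s₃ f₃) * ν.real (cyl s₄ f₄)
  shift : ∀ a b : ℤ, ν.real (cyl (Finset.Ico (a + 1) (b + 1)) fun _ => false) =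
    ν.real (cyl (Finset.Ico a b) fun _ => false)
  pos : ∀ (s : Finset ℤ) (f : ZSeq Bool), 0 < ν.real (cyl s f)

theorem measurable_lineProj : Measurable lineProj :=
  measurable_pi_lambda _ fun i => measurable_pi_apply ((i, 0) : ℤ × ℤ)

/-- The embedding of the line `ℤ × {0}`. -/
def lineEmb : ℤ ↪ ℤ × ℤ := ⟨fun i => (i, 0), fun _ _ hij => congrArg Prod.fst hij⟩

theorem lineEmb_apply (i : ℤ) : lineEmb i = (i, 0) := rfl

theorem mem_cyl_lineEmb {s : Finset ℤ} {f : ZSeq Bool} {ω : Cfg2} :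
    ω ∈ cyl (s.map lineEmb) (fun x => f x.1) ↔ lineProj ω ∈ cyl s f := by
  simp only [cyl, Set.mem_ofPred_eq, Finset.forall_mem_map, lineEmb_apply, lineProj]

theorem schonmann_real_cyl (μ : Measure Cfg2) (s : Finset ℤ) (f : ZSeq Bool) :
    (schonmann μ).real (cyl s f) = μ.real (cyl (s.map lineEmb) fun x => f x.1) := by
  rw [schonmann, map_measureReal_apply measurable_lineProj (measurableSet_cyl s f)]
  congr 1
  ext ω
  exact mem_cyl_lineEmb.symm

theorem IsPlusPhase.isFKGLine {β h : ℝ} (hβ : 0 ≤ β) {μ : Measure Cfg2}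
    (hμ : IsPlusPhase β h μ) : IsFKGLine (schonmann μ) where
  prob := by
    have := hμ.1
    exact Measure.isProbabilityMeasure_map measurable_lineProj.aemeasurable
  four s₁ s₂ s₃ s₄ f₁ f₂ f₃ f₄ hE := by
    simp only [schonmann_real_cyl]
    refine hμ.four_cyl hβ fun ω hω ω' hω' => ?_
    rw [mem_cyl_lineEmb] at hω hω' ⊢
    rw [mem_cyl_lineEmb]
    exact hE _ hω _ hω'
  shift a b := by
    simp only [schonmann_real_cyl]
    rw [← hμ.minus_translate hβ ((Finset.Ico a b).map lineEmb)]
    congr 2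
    ext ⟨x, y⟩
    simp only [Finset.mem_map, lineEmb_apply, Finset.mem_Ico, Prod.mk.injEq,
      addRightEmbedding_apply, Prod.exists, Prod.mk_add_mk]
    constructor
    · rintro ⟨z, hz, rfl, rfl⟩
      exact ⟨z - 1, 0, ⟨z - 1, by omega, rfl, rfl⟩, by omega, by omega⟩
    · rintro ⟨z, w, ⟨u, hu, rfl, rfl⟩, h1, h2⟩
      exact ⟨u + 1, by omega, by omega, by omega⟩
  pos s f := by
    rw [schonmann_real_cyl]
    exact hμ.cyl_pos _ _

theorem exists_isBernoulliProd {ρ : ℝ} (hρ : ρ ∈ Set.Icc (0 : ℝ) 1) :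
    ∃ π : Measure (ZSeq Bool), IsBernoulliProd ρ π := by
  set m : Measure Bool :=
    ENNReal.ofReal ρ • Measure.dirac true + ENNReal.ofReal (1 - ρ) • Measure.dirac false with hm
  have hprob : IsProbabilityMeasure m := by
    constructor
    simp only [hm, Measure.add_apply, Measure.smul_apply, measure_univ, smul_eq_mul, mul_one]
    rw [← ENNReal.ofReal_add hρ.1 (by linarith [hρ.2])]
    simp
  refine ⟨Measure.infinitePi fun _ : ℤ => m, inferInstance, fun s f => ?_⟩
  have hset : {η : ZSeq Bool | ∀ i ∈ s, η i = f i} = Set.pi s (fun i => {f i}) := by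
    ext η
    simp [Set.mem_pi]
  rw [hset, Measure.infinitePi_pi _ fun i _ => measurableSet_singleton _]
  refine Finset.prod_congr rfl fun i _ => ?_
  cases hfi : f i <;> simp [hm]

theorem IsBernoulliProd.real_cyl {ρ : ℝ} (hρ : ρ ∈ Set.Icc (0 : ℝ) 1) {π : Measure (ZSeq Bool)}
    (hπ : IsBernoulliProd ρ π) (s : Finset ℤ) (f : ZSeq Bool) :
    π.real (cyl s f) = ∏ i ∈ s, if f i then ρ else 1 - ρ := by
  rw [Measure.real, cyl, hπ.2 s f, ENNReal.toReal_prod]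
  refine Finset.prod_congr rfl fun i _ => ENNReal.toReal_ofReal ?_
  split_ifs
  · exact hρ.1
  · linarith [hρ.2]

/-- Dominating `π_ρ` forces the probability of minus spins on `t` to be at most `(1-ρ)^|t|`, and
this survives the supremum over `ρ`. -/
theorem minus_le_pow_sSup (ν : Measure (ZSeq Bool)) [IsProbabilityMeasure ν] (t : Finset ℤ) :
    ν.real (cyl t fun _ => false) ≤ (1 - sSup {ρ : ℝ | ρ ∈ Set.Icc (0 : ℝ) 1 ∧
        ∀ π : Measure (ZSeq Bool), IsBernoulliProd ρ π → StochDom π ν}) ^ t.card := by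
  set S : Set ℝ := {ρ : ℝ | ρ ∈ Set.Icc (0 : ℝ) 1 ∧
        ∀ π : Measure (ZSeq Bool), IsBernoulliProd ρ π → StochDom π ν} with hS
  have hmem : ∀ ρ ∈ S, ν.real (cyl t fun _ => false) ≤ (1 - ρ) ^ t.card := by
    rintro ρ ⟨hρ, hdom⟩
    obtain ⟨π, hπ⟩ := exists_isBernoulliProd hρ
    have := hπ.1
    have hcm := measurableSet_cyl t (fun _ => false)
    have h1 := hdom π hπ (cyl t fun _ => false)ᶜ hcm.compl fun x y hxy hx hy =>
      hx fun i hi => by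
        have h2 := hxy i
        rw [hy i hi] at h2
        exact le_antisymm h2 bot_le
    have h3 : π.real (cyl t fun _ => false)ᶜ ≤ ν.real (cyl t fun _ => false)ᶜ :=
      ENNReal.toReal_mono (measure_ne_top _ _) h1
    rw [probReal_compl_eq_one_sub hcm, probReal_compl_eq_one_sub hcm, hπ.real_cyl hρ] at h3
    simp only [Bool.false_eq_true, if_false, Finset.prod_const] at h3
    linarith
  rcases S.eq_empty_or_nonempty with hE | hne
  · rw [hE]
    simp
  · have hbdd : BddAbove S := ⟨1, fun ρ hρ => hρ.1.2⟩
    have hcl : IsClosed {ρ : ℝ | ν.real (cyl t fun _ => false) ≤ (1 - ρ) ^ t.card} :=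
      isClosed_le continuous_const (by fun_prop)
    exact hcl.closure_subset_iff.2 hmem (csSup_mem_closure hne hbdd)

theorem ratio_le_of_logConvex_of_le_pow {u : ℕ → ℝ} {q : ℝ} (hq : 0 ≤ q) (hu : ∀ k, 0 < u k)
    (hconv : ∀ k, u (k + 1) * u (k + 1) ≤ u (k + 2) * u k) (hle : ∀ k, u k ≤ q ^ k) (k : ℕ) :
    u (k + 1) ≤ q * u k := by
  have hq0 : 0 < q := by
    refine lt_of_le_of_ne hq fun h0 => ?_
    have h1 := hle 1
    rw [← h0, pow_one] at h1
    exact absurd (hu 1) (not_lt.2 h1)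
  by_contra hcon
  rw [not_le] at hcon
  set r := u (k + 1) / u k with hr
  have hqr : q < r := (lt_div_iff₀ (hu k)).2 hcon
  have hr0 : 0 < r := hq0.trans hqr
  have hratio : ∀ m, r * u (k + m) ≤ u (k + m + 1) := by
    intro m
    induction m with
    | zero =>
      rw [add_zero, hr, div_mul_cancel₀ _ (hu k).ne']
    | succ m ih =>
      have h1 := hconv (k + m)
      refine le_of_mul_le_mul_right ?_ (hu (k + m))
      calc r * u (k + (m + 1)) * u (k + m) = (r * u (k + m)) * u (k + m + 1) := by
            rw [← add_assoc]; ring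
        _ ≤ u (k + m + 1) * u (k + m + 1) := mul_le_mul_of_nonneg_right ih (hu _).le
        _ ≤ _ := h1
  have hgrow : ∀ m, u k * r ^ m ≤ u (k + m) := by
    intro m
    induction m with
    | zero => simp
    | succ m ih =>
      calc u k * r ^ (m + 1) = r * (u k * r ^ m) := by ring
        _ ≤ r * u (k + m) := mul_le_mul_of_nonneg_left ih hr0.le
        _ ≤ _ := hratio m
  have hbound : ∀ m, (r / q) ^ m ≤ q ^ k / u k := by
    intro m
    rw [div_pow, div_le_div_iff₀ (pow_pos hq0 m) (hu k), ← pow_add]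
    calc r ^ m * u k = u k * r ^ m := mul_comm _ _
      _ ≤ _ := (hgrow m).trans (hle _)
  obtain ⟨m, hm⟩ := ((tendsto_pow_atTop_atTop_of_one_lt
    ((one_lt_div hq0).2 hqr)).eventually_gt_atTop (q ^ k / u k)).exists
  exact absurd (hbound m) (not_le.2 hm)

theorem IsFKGLine.real_minus_Ico {ν : Measure (ZSeq Bool)} (hν : IsFKGLine ν) (a : ℤ) (k : ℕ) :
    ν.real (cyl (Finset.Ico a (a + k)) fun _ => false) =
      ν.real (cyl (Finset.Ico 0 (k : ℤ)) fun _ => false) := by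
  induction a using Int.induction_on with
  | zero => rw [zero_add]
  | succ i ih => rw [← ih, ← hν.shift (i : ℤ) (i + k), add_right_comm]
  | pred i ih =>
    rw [← ih, ← hν.shift]
    congr 3 <;> ring

theorem IsFKGLine.minus_ratio_le {ν : Measure (ZSeq Bool)} (hν : IsFKGLine ν) {q : ℝ}
    (hq : 0 ≤ q) (hle : ∀ t : Finset ℤ, ν.real (cyl t fun _ => false) ≤ q ^ t.card)
    {a i : ℤ} (hai : a ≤ i) :
    ν.real (cyl (Finset.Ico a (i + 1)) fun _ => false) ≤
      q * ν.real (cyl (Finset.Ico a i) fun _ => false) := by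
  obtain ⟨k, rfl⟩ := Int.le.dest hai
  have h1 := ratio_le_of_logConvex_of_le_pow
    (u := fun k => ν.real (cyl (Finset.Ico 0 (k : ℤ)) fun _ => false)) hq
    (fun k => hν.pos _ _) ?_ (fun k => by simpa using hle (Finset.Ico 0 (k : ℤ))) k
  · rw [← hν.real_minus_Ico a, ← hν.real_minus_Ico a] at h1
    convert h1 using 4
    push_cast
    ring
  · intro k
    have h2 := hν.four (Finset.Ico 0 ((k + 1 : ℕ) : ℤ)) (Finset.Ico 1 (1 + ((k + 1 : ℕ) : ℤ)))
      (Finset.Ico 0 ((k + 2 : ℕ) : ℤ)) (Finset.Ico 1 (1 + (k : ℤ)))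
      (fun _ => false) (fun _ => false) (fun _ => false) (fun _ => false) ?_
    · rwa [hν.real_minus_Ico 1, hν.real_minus_Ico 1] at h2
    · intro ω hω ω' hω'
      constructor <;> intro i hi <;> rw [Finset.mem_Ico] at hi
      · by_cases hi' : i < (k + 1 : ℕ)
        · simp [hω i (Finset.mem_Ico.2 ⟨hi.1, hi'⟩)]
        · simp [hω' i (Finset.mem_Ico.2 (by push_cast at hi hi' ⊢; omega))]
      · simp [hω i (Finset.mem_Ico.2 (by push_cast; omega)),
          hω' i (Finset.mem_Ico.2 (by push_cast; omega))]

/-- Conditionally on any configuration on `[a,i)`, a minus spin at `i` has probability at most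
`q`. -/
theorem IsFKGLine.cyl_succ_le {ν : Measure (ZSeq Bool)} (hν : IsFKGLine ν) {q : ℝ}
    (hq : 0 ≤ q) (hle : ∀ t : Finset ℤ, ν.real (cyl t fun _ => false) ≤ q ^ t.card)
    {a i : ℤ} (hai : a ≤ i) {f : ZSeq Bool} (hf : f i = false) :
    ν.real (cyl (Finset.Ico a (i + 1)) f) ≤ q * ν.real (cyl (Finset.Ico a i) f) := by
  have h1 := hν.four (Finset.Ico a (i + 1)) (Finset.Ico a i) (Finset.Ico a (i + 1))
    (Finset.Ico a i) f (fun _ => false) (fun _ => false) f ?_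
  · have h2 := hν.pos (Finset.Ico a i) (fun _ => false)
    have h3 := mul_le_mul_of_nonneg_right (hν.minus_ratio_le hq hle hai)
      (hν.pos (Finset.Ico a i) f).le
    refine le_of_mul_le_mul_right ?_ h2
    linarith
  · intro ω hω ω' hω'
    constructor <;> intro j hj <;> rw [Finset.mem_Ico] at hj
    · by_cases hj' : j < i
      · simp [hω' j (Finset.mem_Ico.2 ⟨hj.1, hj'⟩)]
      · obtain rfl : j = i := by omega
        simp [hω j (Finset.mem_Ico.2 hj), hf]
    · simp [hω j (Finset.mem_Ico.2 (by omega)), hω' j (Finset.mem_Ico.2 hj)]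

/-- The configuration equal to `b` to the left of `a`, whose plus spins on `[a,∞)` are the
elements of `T`. -/
def cfgOf (b : Bool) (a : ℤ) (T : Finset ℤ) : ZSeq Bool :=
  fun j => if j < a then b else decide (j ∈ T)

theorem cfgOf_mono (b : Bool) (a : ℤ) : Monotone (cfgOf b a) := by
  intro T T' hT j
  unfold cfgOf
  split_ifs
  · exact le_rfl
  · by_cases hj : j ∈ T
    · simp [hj, hT hj]
    · simp [hj]

theorem measure_cyl_inter_eq_sum (m : Measure (ZSeq Bool)) {A a : ℤ} (b : Bool)
    (k : ℕ) {C : Set (ZSeq Bool)}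
    (hC : ∀ η η' : ZSeq Bool, (∀ i ∈ Finset.Ico a (a + k), η i = η' i) → η ∈ C → η' ∈ C)
    (hA : A ≤ a) :
    m (cyl (Finset.Ico A a) (fun _ => b) ∩ C) =
      ∑ T ∈ (Finset.Ico a (a + k)).powerset,
        C.indicator (fun _ => m (cyl (Finset.Ico A (a + k)) (cfgOf b a T))) (cfgOf b a T) := by
  classical
  have h1 : cyl (Finset.Ico A a) (fun _ => b) ∩ C =
      ⋃ T ∈ (Finset.Ico a (a + k)).powerset.filter (fun T => cfgOf b a T ∈ C),
        cyl (Finset.Ico A (a + k)) (cfgOf b a T) := by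
    ext η
    simp only [Set.mem_inter_iff, Set.mem_iUnion, exists_prop, Finset.mem_filter,
      Finset.mem_powerset]
    constructor
    · rintro ⟨hη, hηC⟩
      have hag : ∀ i ∈ Finset.Ico A (a + k),
          η i = cfgOf b a ((Finset.Ico a (a + k)).filter fun j => η j = true) i := by
        intro i hi
        rw [Finset.mem_Ico] at hi
        unfold cfgOf
        split_ifs with hia
        · exact hη i (Finset.mem_Ico.2 ⟨hi.1, hia⟩)
        · simp [not_lt.1 hia, hi.2]
      exact ⟨_, ⟨Finset.filter_subset _ _, hC _ _ (fun i hi => hag i (by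
        rw [Finset.mem_Ico] at hi ⊢; omega)) hηC⟩, hag⟩
    · rintro ⟨T, ⟨hT, hTC⟩, hη⟩
      refine ⟨fun i hi => ?_, hC _ _ (fun i hi => (hη i ?_).symm) hTC⟩
      · rw [Finset.mem_Ico] at hi
        rw [hη i (Finset.mem_Ico.2 (by omega))]
        simp [cfgOf, hi.2]
      · rw [Finset.mem_Ico] at hi ⊢
        omega
  rw [h1, measure_biUnion_finset, Finset.sum_filter]
  · exact Finset.sum_congr rfl fun T _ => by rw [Set.indicator_apply]
  · intro T hT T' hT' hne
    refine Set.disjoint_left.2 fun η hη hη' => hne ?_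
    have hsub := Finset.mem_powerset.1 (Finset.mem_filter.1 hT).1
    have hsub' := Finset.mem_powerset.1 (Finset.mem_filter.1 hT').1
    ext j
    by_cases hj : j ∈ Finset.Ico a (a + k)
    · have hj' := Finset.mem_Ico.1 hj
      have hjA : j ∈ Finset.Ico A (a + k) := Finset.mem_Ico.2 (by omega)
      have := (hη j hjA).symm.trans (hη' j hjA)
      simpa [cfgOf, not_lt.2 hj'.1] using this
    · exact ⟨fun H => absurd (hsub H) hj, fun H => absurd (hsub' H) hj⟩
  · exact fun T _ => measurableSet_cyl _ _

theorem real_cyl_inter_eq_sum (m : Measure (ZSeq Bool)) [IsFiniteMeasure m] {A a : ℤ} (b : Bool)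
    (k : ℕ) {C : Set (ZSeq Bool)}
    (hC : ∀ η η' : ZSeq Bool, (∀ i ∈ Finset.Ico a (a + k), η i = η' i) → η ∈ C → η' ∈ C)
    (hA : A ≤ a) :
    m.real (cyl (Finset.Ico A a) (fun _ => b) ∩ C) =
      ∑ T ∈ (Finset.Ico a (a + k)).powerset,
        m.real (cyl (Finset.Ico A (a + k)) (cfgOf b a T)) * C.indicator 1 (cfgOf b a T) := by
  classical
  rw [Measure.real, measure_cyl_inter_eq_sum m b k hC hA, ENNReal.toReal_sum]
  · refine Finset.sum_congr rfl fun T _ => ?_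
    by_cases hT : cfgOf b a T ∈ C <;> simp [hT, Measure.real]
  · intro T _
    by_cases hT : cfgOf b a T ∈ C <;> simp [hT]

theorem real_cyl_Ico_succ (m : Measure (ZSeq Bool)) [IsFiniteMeasure m] {A i : ℤ} (hA : A ≤ i)
    {f f₀ f₁ : ZSeq Bool} (h₀ : ∀ j < i, f₀ j = f j) (h₁ : ∀ j < i, f₁ j = f j)
    (h₀i : f₀ i = false) (h₁i : f₁ i = true) :
    m.real (cyl (Finset.Ico A i) f) =
      m.real (cyl (Finset.Ico A (i + 1)) f₀) + m.real (cyl (Finset.Ico A (i + 1)) f₁) := by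
  rw [← measureReal_union ?_ (measurableSet_cyl _ _)]
  · congr 1
    ext η
    simp only [Set.mem_union, mem_cyl, Finset.mem_Ico]
    constructor
    · intro hη
      cases hηi : η i
      · left
        intro j hj
        by_cases hji : j < i
        · rw [h₀ j hji, hη j ⟨hj.1, hji⟩]
        · obtain rfl : j = i := by omega
          rw [h₀i, hηi]
      · right
        intro j hj
        by_cases hji : j < i
        · rw [h₁ j hji, hη j ⟨hj.1, hji⟩]
        · obtain rfl : j = i := by omega
          rw [h₁i, hηi]
    · rintro (hη | hη) j hj
      · rw [hη j (by omega), h₀ j hj.2]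
      · rw [hη j (by omega), h₁ j hj.2]
  · refine Set.disjoint_left.2 fun η hη hη' => ?_
    have hi : i ∈ Finset.Ico A (i + 1) := Finset.mem_Ico.2 (by omega)
    have := (hη i hi).symm.trans (hη' i hi)
    simp [h₀i, h₁i] at this

/-- Sequential domination: if, revealing the sites of `[a,a+k)` one at a time, each is minus with
conditional probability at most `1-ρ` under `w` and exactly `1-ρ` under `v`, then `w` dominates
`v`. -/
theorem sum_le_sum_of_sequential {ρ : ℝ} (hρ : ρ ∈ Set.Icc (0 : ℝ) 1) (a : ℤ)
    {v w : ℕ → Finset ℤ → ℝ} (hv0 : v 0 ∅ = 1)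
    (hw : ∀ k : ℕ, ∀ T ⊆ Finset.Ico a (a + (k : ℤ)), w k T = w (k + 1) T + w (k + 1) (insert (a + k) T))
    (hwle : ∀ k : ℕ, ∀ T ⊆ Finset.Ico a (a + (k : ℤ)), w (k + 1) T ≤ (1 - ρ) * w k T)
    (hv : ∀ k : ℕ, ∀ T ⊆ Finset.Ico a (a + (k : ℤ)), v (k + 1) T = (1 - ρ) * v k T ∧
      v (k + 1) (insert (a + k) T) = ρ * v k T)
    (k : ℕ) {F : Finset ℤ → ℝ} (hF : Monotone F) :
    w 0 ∅ * ∑ T ∈ (Finset.Ico a (a + k)).powerset, v k T * F T ≤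
      ∑ T ∈ (Finset.Ico a (a + k)).powerset, w k T * F T := by
  classical
  induction k generalizing F with
  | zero => simp [hv0]
  | succ k ih =>
    have hins : Finset.Ico a (a + (k + 1 : ℕ)) = insert (a + k : ℤ) (Finset.Ico a (a + k)) := by
      ext j
      simp only [Finset.mem_Ico, Finset.mem_insert]
      push_cast
      omega
    have hnot : (a + k : ℤ) ∉ Finset.Ico a (a + k) := by simp
    set G : Finset ℤ → ℝ := fun T => ρ * F (insert (a + k : ℤ) T) + (1 - ρ) * F T with hG
    have hGm : Monotone G := fun T T' hT => add_le_add
      (mul_le_mul_of_nonneg_left (hF (Finset.insert_subset_insert _ hT)) hρ.1)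
      (mul_le_mul_of_nonneg_left (hF hT) (by linarith [hρ.2]))
    rw [hins, Finset.sum_powerset_insert hnot, Finset.sum_powerset_insert hnot,
      ← Finset.sum_add_distrib, ← Finset.sum_add_distrib]
    have hvG : ∑ T ∈ (Finset.Ico a (a + k)).powerset, (v (k + 1) T * F T +
        v (k + 1) (insert (a + k : ℤ) T) * F (insert (a + k : ℤ) T)) =
        ∑ T ∈ (Finset.Ico a (a + k)).powerset, v k T * G T := by
      refine Finset.sum_congr rfl fun T hT => ?_
      obtain ⟨h1, h2⟩ := hv k T (Finset.mem_powerset.1 hT)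
      rw [h1, h2]
      ring
    rw [hvG]
    refine (ih hGm).trans (Finset.sum_le_sum fun T hT => ?_)
    have h1 := hw k T (Finset.mem_powerset.1 hT)
    have h2 := hwle k T (Finset.mem_powerset.1 hT)
    have h3 := hF (Finset.subset_insert (a + k : ℤ) T)
    have h4 : w (k + 1) (insert (a + k : ℤ) T) = w k T - w (k + 1) T := by linarith
    rw [h4]
    have h5 := mul_nonneg (sub_nonneg.2 h2) (sub_nonneg.2 h3)
    simp only [hG]
    linarith

/-- Conditioning on the block `[A,a)` being constantly `b`, increasing events on `[a,a+k)` are at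
least as likely as under `π_ρ`. -/
theorem IsFKGLine.bernoulli_le_inter {ν : Measure (ZSeq Bool)} (hν : IsFKGLine ν) {ρ : ℝ}
    (hρ : ρ ∈ Set.Icc (0 : ℝ) 1)
    (hle : ∀ t : Finset ℤ, ν.real (cyl t fun _ => false) ≤ (1 - ρ) ^ t.card)
    {π : Measure (ZSeq Bool)} (hπ : IsBernoulliProd ρ π) {A a : ℤ} (hA : A ≤ a) (b : Bool)
    (k : ℕ) {C : Set (ZSeq Bool)} (hup : ∀ ⦃x y : ZSeq Bool⦄, x ≤ y → x ∈ C → y ∈ C)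
    (hC : ∀ η η' : ZSeq Bool, (∀ i ∈ Finset.Ico a (a + k), η i = η' i) → η ∈ C → η' ∈ C) :
    ν.real (cyl (Finset.Ico A a) fun _ => b) * π.real C ≤
      ν.real (cyl (Finset.Ico A a) (fun _ => b) ∩ C) := by
  have := hν.prob
  have := hπ.1
  have hπC : π.real C = ∑ T ∈ (Finset.Ico a (a + k)).powerset,
      π.real (cyl (Finset.Ico a (a + k)) (cfgOf b a T)) * C.indicator 1 (cfgOf b a T) := by
    rw [← real_cyl_inter_eq_sum π b k hC le_rfl]
    congr 1
    simp [cyl]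
  rw [real_cyl_inter_eq_sum ν b k hC hA, hπC]
  have hnotin : ∀ (k : ℕ) (T : Finset ℤ), T ⊆ Finset.Ico a (a + k) → cfgOf b a T (a + k) = false :=
    fun k T hT => by
      have h1 : (a + k : ℤ) ∉ T := fun h1 => by simpa using hT h1
      simp [cfgOf, h1]
  have hinsin : ∀ (k : ℕ) (T : Finset ℤ), cfgOf b a (insert (a + k : ℤ) T) (a + k) = true :=
    fun k T => by simp [cfgOf]
  have hinslt : ∀ (k : ℕ) (T : Finset ℤ), ∀ j < (a + k : ℤ),
      cfgOf b a (insert (a + k : ℤ) T) j = cfgOf b a T j := fun k T j hj => by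
    simp [cfgOf, hj.ne]
  have hcast : ∀ k : ℕ, a + ((k + 1 : ℕ) : ℤ) = a + k + 1 := fun k => by push_cast; ring
  have key := sum_le_sum_of_sequential hρ a
    (v := fun k T => π.real (cyl (Finset.Ico a (a + k)) (cfgOf b a T)))
    (w := fun k T => ν.real (cyl (Finset.Ico A (a + k)) (cfgOf b a T)))
    (by simp [cyl]) ?_ ?_ ?_ k (F := fun T => C.indicator 1 (cfgOf b a T)) ?_
  · convert key using 2
    congr 1
    ext η
    simp only [mem_cyl, Finset.mem_Ico, Nat.cast_zero, add_zero]
    refine forall₂_congr fun i hi => ?_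
    simp [cfgOf, hi.2]
  · intro k T hT
    simp only [hcast]
    exact real_cyl_Ico_succ ν (by omega) (fun _ _ => rfl) (hinslt k T) (hnotin k T hT)
      (hinsin k T)
  · intro k T hT
    simp only [hcast]
    exact hν.cyl_succ_le (by linarith [hρ.2]) hle (by omega) (hnotin k T hT)
  · intro k T hT
    have hnot : (a + k : ℤ) ∉ Finset.Ico a (a + k) := by simp
    have hins : Finset.Ico a (a + (k + 1 : ℕ)) = insert (a + k : ℤ) (Finset.Ico a (a + k)) := by
      ext j
      simp only [Finset.mem_Ico, Finset.mem_insert]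
      push_cast
      omega
    simp only [hπ.real_cyl hρ, hins, Finset.prod_insert hnot, hnotin k T hT, hinsin k T]
    refine ⟨by simp, ?_⟩
    simp only [if_true]
    congr 1
    refine Finset.prod_congr rfl fun j hj => ?_
    rw [hinslt k T j (Finset.mem_Ico.1 hj).2]
  · intro T T' hT
    have hm := cfgOf_mono b a hT
    by_cases h1 : cfgOf b a T ∈ C
    · simp [h1, hup hm h1]
    · simp only [Set.indicator_of_notMem h1]
      exact Set.indicator_nonneg (fun _ _ => zero_le_one) _

theorem blockEvt_eq_cyl (n l : ℕ) (b : Bool) :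
    blockEvt n l b = cyl (Finset.Ico (-((n : ℤ) + l)) (-(n : ℤ) + 1)) fun _ => b := by
  ext η
  simp only [blockEvt, Set.mem_ofPred_eq, mem_cyl, Finset.mem_Ico, Int.lt_add_one_iff, and_imp]

theorem CylTendsto.tendsto_local {μs : ℕ → Measure (ZSeq Bool)} {μ : Measure (ZSeq Bool)}
    (hμ : CylTendsto μs μ) (a : ℤ) (k : ℕ) {C : Set (ZSeq Bool)}
    (hC : ∀ η η' : ZSeq Bool, (∀ i ∈ Finset.Ico a (a + k), η i = η' i) → η ∈ C → η' ∈ C) :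
    Tendsto (fun n => μs n C) atTop (𝓝 (μ C)) := by
  have h1 : ∀ m : Measure (ZSeq Bool), m C = ∑ T ∈ (Finset.Ico a (a + k)).powerset,
      C.indicator (fun _ => m (cyl (Finset.Ico a (a + k)) (cfgOf true a T))) (cfgOf true a T) := by
    intro m
    rw [← measure_cyl_inter_eq_sum m true k hC le_rfl]
    congr 1
    simp [cyl]
  simp only [h1]
  refine tendsto_finsetSum _ fun T _ => ?_
  by_cases hT : cfgOf true a T ∈ C
  · simp only [Set.indicator_of_mem hT]
    exact hμ _ _
  · simp only [Set.indicator_of_notMem hT]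
    exact tendsto_const_nhds

theorem measurableSet_of_local (s : Finset ℤ) {C : Set (ZSeq Bool)}
    (hC : ∀ η η' : ZSeq Bool, (∀ i ∈ s, η i = η' i) → η ∈ C → η' ∈ C) : MeasurableSet C := by
  have h1 : C = s.restrict ⁻¹' (s.restrict '' C) := by
    refine Set.Subset.antisymm (Set.subset_preimage_image _ _) ?_
    rintro η ⟨η', hη', heq⟩
    exact hC η' η (fun i hi => congrFun heq ⟨i, hi⟩) hη'
  rw [h1]
  exact (Finset.measurable_restrict s) (Set.toFinite _).measurableSet

/-- Domination of increasing local events extends to all increasing measurable events. -/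
theorem stochDom_of_local {π ν : Measure (ZSeq Bool)} [IsFiniteMeasure π] [IsFiniteMeasure ν]
    (hloc : ∀ (N : ℕ) (C : Set (ZSeq Bool)), (∀ ⦃x y : ZSeq Bool⦄, x ≤ y → x ∈ C → y ∈ C) →
      (∀ η η' : ZSeq Bool, (∀ i ∈ Finset.Icc (-(N : ℤ)) N, η i = η' i) → η ∈ C → η' ∈ C) →
      π C ≤ ν C) : StochDom π ν := by
  intro B hB hup
  by_contra hcon
  rw [not_le] at hcon
  obtain ⟨K, hKB, hK, hlt⟩ := hB.exists_lt_isCompact hcon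
  refine absurd hlt (not_lt.2 ?_)
  set D : ℕ → ZSeq Bool → Set (ZSeq Bool) := fun N η =>
    {κ | κ ∈ K ∧ ∀ i ∈ Finset.Icc (-(N : ℤ)) N, κ i ≤ η i} with hD
  set C : ℕ → Set (ZSeq Bool) := fun N => {η | (D N η).Nonempty} with hCdef
  have hCloc : ∀ N : ℕ, ∀ η η' : ZSeq Bool, (∀ i ∈ Finset.Icc (-(N : ℤ)) N, η i = η' i) →
      η ∈ C N → η' ∈ C N := by
    rintro N η η' hη ⟨κ, hκ, hκη⟩
    exact ⟨κ, hκ, fun i hi => (hκη i hi).trans (hη i hi).le⟩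
  have hDanti : ∀ η, ∀ N M, N ≤ M → D M η ⊆ D N η := by
    rintro η N M hNM κ ⟨hκ, hκη⟩
    refine ⟨hκ, fun i hi => hκη i ?_⟩
    rw [Finset.mem_Icc] at hi ⊢
    omega
  have hKC : ∀ N, π K ≤ ν (C N) := by
    intro N
    refine (measure_mono fun κ hκ => ?_).trans (hloc N (C N) ?_ (hCloc N))
    · exact ⟨κ, hκ, fun i _ => le_rfl⟩
    · rintro x y hxy ⟨κ, hκ, hκx⟩
      exact ⟨κ, hκ, fun i hi => (hκx i hi).trans (hxy i)⟩
  have hlim : Tendsto (fun N => ν (C N)) atTop (𝓝 (ν (⋂ N, C N))) :=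
    tendsto_measure_iInter_atTop
      (fun N => (measurableSet_of_local _ (hCloc N)).nullMeasurableSet)
      (fun N M hNM η hη => hη.mono (hDanti η N M hNM)) ⟨0, measure_ne_top _ _⟩
  refine (ge_of_tendsto' hlim hKC).trans (measure_mono fun η hη => ?_)
  have hclosed : ∀ N, IsClosed (D N η) := by
    intro N
    refine hK.isClosed.inter ?_
    have : {κ : ZSeq Bool | ∀ i ∈ Finset.Icc (-(N : ℤ)) N, κ i ≤ η i} =
        ⋂ i ∈ Finset.Icc (-(N : ℤ)) N, (fun κ : ZSeq Bool => κ i) ⁻¹' {b | b ≤ η i} := by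
      ext κ
      simp
    change IsClosed {κ : ZSeq Bool | ∀ i ∈ Finset.Icc (-(N : ℤ)) N, κ i ≤ η i}
    rw [this]
    exact isClosed_biInter fun i _ => (isClosed_discrete _).preimage (continuous_apply i)
  obtain ⟨κ, hκ⟩ := IsCompact.nonempty_iInter_of_sequence_nonempty_isCompact_isClosed
    (fun N => D N η) (fun N => hDanti η N (N + 1) (Nat.le_succ N)) (fun N => Set.mem_iInter.1 hη N)
    (hK.of_isClosed_subset (hclosed 0) fun κ hκ => hκ.1) hclosed
  rw [Set.mem_iInter] at hκ
  refine hup (fun i => ?_) (hKB (hκ 0).1)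
  exact (hκ i.natAbs).2 i (Finset.mem_Icc.2 (by omega))

theorem IsFKGLine.stochDom_condLimit {ν : Measure (ZSeq Bool)} (hν : IsFKGLine ν) {ρ : ℝ}
    (hρ : ρ ∈ Set.Icc (0 : ℝ) 1)
    (hle : ∀ t : Finset ℤ, ν.real (cyl t fun _ => false) ≤ (1 - ρ) ^ t.card)
    {π : Measure (ZSeq Bool)} (hπ : IsBernoulliProd ρ π) (b : Bool) {ν' : Measure (ZSeq Bool)}
    (hν' : IsCondLimitMeasure ν b ν') : StochDom π ν' := by
  have := hν.prob
  have := hπ.1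
  obtain ⟨νseq, hseq, hlim⟩ := hν'
  have hpos : ∀ n l, ν (blockEvt n l b) ≠ 0 := fun n l h0 => by
    have h1 := hν.pos (Finset.Ico (-((n : ℤ) + l)) (-(n : ℤ) + 1)) (fun _ => b)
    rw [← blockEvt_eq_cyl, Measure.real, h0] at h1
    simp at h1
  have hcondprob : ∀ n l, IsProbabilityMeasure (ν[|blockEvt n l b]) := fun n l =>
    cond_isProbabilityMeasure (hpos n l)
  have huniv : ∀ n, νseq n Set.univ = 1 := by
    intro n
    have h1 := (hseq n).tendsto_local 0 0 (C := Set.univ) fun _ _ _ _ => trivial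
    exact tendsto_nhds_unique h1 (by simp)
  have hfin : IsFiniteMeasure ν' := by
    have h1 := hlim.tendsto_local 0 0 (C := Set.univ) fun _ _ _ _ => trivial
    simp only [huniv] at h1
    exact ⟨by rw [tendsto_nhds_unique h1 tendsto_const_nhds]; simp⟩
  refine stochDom_of_local fun N C hup hC => ?_
  have hC' : ∀ n : ℕ, N < n → ∀ η η' : ZSeq Bool,
      (∀ i ∈ Finset.Ico (-(n : ℤ) + 1) (-(n : ℤ) + 1 + (n + N : ℕ)), η i = η' i) →
      η ∈ C → η' ∈ C := by
    intro n hn η η' hη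
    refine hC η η' fun i hi => hη i ?_
    rw [Finset.mem_Icc] at hi
    rw [Finset.mem_Ico]
    push_cast
    omega
  have hcond : ∀ n, N < n → ∀ l, π C ≤ ν[|blockEvt n l b] C := by
    intro n hn l
    have h1 := hν.bernoulli_le_inter hρ hle hπ
      (A := -((n : ℤ) + l)) (a := -(n : ℤ) + 1) (by omega) b (n + N) hup (hC' n hn)
    rw [← blockEvt_eq_cyl] at h1
    have hbm : MeasurableSet (blockEvt n l b) := by
      rw [blockEvt_eq_cyl]
      exact measurableSet_cyl _ _
    have hbp : 0 < ν.real (blockEvt n l b) :=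
      ENNReal.toReal_pos (hpos n l) (measure_ne_top _ _)
    have h2 : π.real C ≤ (ν[|blockEvt n l b]).real C := by
      rw [measureReal_def ν[|blockEvt n l b], cond_apply hbm, ENNReal.toReal_mul,
        ENNReal.toReal_inv, ← Measure.real, ← Measure.real, ← div_eq_inv_mul, le_div_iff₀ hbp, mul_comm]
      exact h1
    exact (ENNReal.toReal_le_toReal (measure_ne_top _ _) (measure_ne_top _ _)).1 h2
  have hseqle : ∀ n, N < n → π C ≤ νseq n C := fun n hn =>
    ge_of_tendsto' ((hseq n).tendsto_local _ _ (hC' n hn)) (hcond n hn)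
  refine ge_of_tendsto (hlim.tendsto_local _ _ (hC' (N + 1) (Nat.lt_succ_self N))) ?_
  filter_upwards [eventually_gt_atTop N] with n hn
  exact hseqle n hn

/-- Let `β > 0`, `h ∈ ℝ` and
`ρ_max^+ = sup{ρ ∈ [0,1] : π_ρ ≤ ν_{β,h}^+}`. Then both `ν_{β,h}^{+,+}` and `ν_{β,h}^{+,-}`
stochastically dominate `π_{ρ_max^+}`. -/
theorem condLimit_measures_dominate_rho_max
    (β h : ℝ) (hβ : 0 < β) (μp : Measure Cfg2) (hμp : IsPlusPhase β h μp)
    (νp νm : Measure (ZSeq Bool))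
    (hνp : IsCondLimitMeasure (schonmann μp) true νp)
    (hνm : IsCondLimitMeasure (schonmann μp) false νm)
    (π : Measure (ZSeq Bool))
    (hπ : IsBernoulliProd (sSup {ρ : ℝ | ρ ∈ Set.Icc (0 : ℝ) 1 ∧
        ∀ π' : Measure (ZSeq Bool), IsBernoulliProd ρ π' →
          StochDom π' (schonmann μp)}) π) :
    StochDom π νp ∧ StochDom π νm := by
  have hν := hμp.isFKGLine hβ.le
  have := hν.prob
  have hle := minus_le_pow_sSup (schonmann μp)
  have hρ : sSup {ρ : ℝ | ρ ∈ Set.Icc (0 : ℝ) 1 ∧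
      ∀ π' : Measure (ZSeq Bool), IsBernoulliProd ρ π' → StochDom π' (schonmann μp)} ∈
      Set.Icc (0 : ℝ) 1 :=
    ⟨Real.sSup_nonneg fun ρ hρ => hρ.1.1, Real.sSup_le (fun ρ hρ => hρ.1.2) zero_le_one⟩
  exact ⟨hν.stochDom_condLimit hρ hle hπ true hνp, hν.stochDom_condLimit hρ hle hπ false hνm⟩
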